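/- Let M, N ≥ 1, let z_1, …, z_M ∈ ℂ be pairwise distinct and S^1, …, S^M ∈ Mat_N(ℂ). For each i, a ∈ {1,…,M} define the gradient matrix G^{i,a} ∈ Mat_N(ℂ) by: G^{i,a}_{pq} = Σ_{k≠i} S^k_{qp}/(z_i − z_k) if a = i, and G^{i,a}_{pq} = S^i_{qp}/(z_i − z_a) if a ≠ i (these are the partial derivatives ∂H_i/∂S^a_{pq} of the Gaudin Hamiltonians H_i = Σ_{k≠i} tr(S^i S^k)/(z_i − z_k)). Then for all i, j ∈ {1,…,M}: Σ_{a=1}^M Σ_{p,q,r,s=1}^N G^{i,a}_{pq} · G^{j,a}_{rs} · (S^a_{rq} δ_{ps} − S^a_{ps} δ_{rq}) = 0. -/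

import Mathlib

open Matrix

/-- The gradient matrices `G^{i,a}_{pq} = ∂H_i/∂S^a_{pq}` of the Gaudin Hamiltonians
`H_i = Σ_{k≠i} tr(S^i S^k)/(z_i − z_k)`:
`G^{i,a}_{pq} = Σ_{k≠i} S^k_{qp}/(z_i−z_k)` if `a = i`, and `S^i_{qp}/(z_i−z_a)` otherwise. -/
noncomputable def gaudinGrad {M N : ℕ} (zs : Fin M → ℂ)
    (S : Fin M → Matrix (Fin N) (Fin N) ℂ) (i a : Fin M) (p q : Fin N) : ℂ :=
  if a = i then ∑ k ∈ Finset.univ.erase i, S k q p / (zs i - zs k)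
  else S i q p / (zs i - zs a)

/-- The alternating trilinear form `tr(X[Y,Z])`. -/
noncomputable def gT {N : ℕ} (X Y Z : Matrix (Fin N) (Fin N) ℂ) : ℂ :=
  (X * Y * Z).trace - (X * Z * Y).trace

theorem gT_swap {N : ℕ} (X Y Z : Matrix (Fin N) (Fin N) ℂ) : gT X Z Y = - gT X Y Z := by
  simp [gT]

theorem gT_cyc {N : ℕ} (X Y Z : Matrix (Fin N) (Fin N) ℂ) : gT Y Z X = gT X Y Z := by
  unfold gT
  rw [Matrix.trace_mul_comm (Y * Z) X, Matrix.trace_mul_cycle Y X Z, Matrix.trace_mul_comm (Z * Y) X,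
    ← Matrix.mul_assoc, ← Matrix.mul_assoc]

theorem gT_self {N : ℕ} (X Y : Matrix (Fin N) (Fin N) ℂ) : gT X Y Y = 0 := by
  simp [gT]

theorem gT_smul {N : ℕ} (X Y Z : Matrix (Fin N) (Fin N) ℂ) (c : ℂ) :
    gT X (c • Y) Z = c * gT X Y Z := by
  simp [gT, mul_sub]

theorem gT_sum {N M : ℕ} (X Z : Matrix (Fin N) (Fin N) ℂ) (Y : Fin M → Matrix (Fin N) (Fin N) ℂ) :
    gT X (∑ k, Y k) Z = ∑ k, gT X (Y k) Z := by
  simp [gT, Matrix.mul_sum, Matrix.sum_mul, Matrix.trace_sum]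

/-- Transposed gradient. -/
noncomputable def gA {M N : ℕ} (zs : Fin M → ℂ)
    (S : Fin M → Matrix (Fin N) (Fin N) ℂ) (i a : Fin M) : Matrix (Fin N) (Fin N) ℂ :=
  if a = i then ∑ k, (zs i - zs k)⁻¹ • S k else (zs i - zs a)⁻¹ • S i

theorem grad_eq {M N : ℕ} (zs : Fin M → ℂ)
    (S : Fin M → Matrix (Fin N) (Fin N) ℂ) (i a : Fin M) (p q : Fin N) :
    gaudinGrad zs S i a p q = gA zs S i a q p := by
  unfold gaudinGrad gA
  split_ifs
  · rw [Finset.sum_erase _ (by simp)]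
    simp [Matrix.sum_apply, div_eq_inv_mul]
  · simp [div_eq_inv_mul]

theorem contract {N : ℕ} (S A B : Matrix (Fin N) (Fin N) ℂ) :
    ∑ p : Fin N, ∑ q : Fin N, ∑ r : Fin N, ∑ s : Fin N,
        A q p * B s r * (S r q * (if p = s then (1 : ℂ) else 0) -
            S p s * (if r = q then (1 : ℂ) else 0)) = gT S A B := by
  have h1 : (S * A * B).trace = ∑ p, ∑ q, ∑ r, A q p * B p r * S r q := by
    rw [← Matrix.trace_mul_cycle A B S]
    simp only [Matrix.trace, Matrix.diag, Matrix.mul_apply, Finset.sum_mul]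
    calc _ = ∑ q, ∑ p, ∑ r, A q p * B p r * S r q :=
          Finset.sum_congr rfl fun q _ => Finset.sum_comm
      _ = _ := Finset.sum_comm
  have h2 : (S * B * A).trace = ∑ p, ∑ q, ∑ s, A q p * B s q * S p s := by
    simp only [Matrix.trace, Matrix.diag, Matrix.mul_apply, Finset.sum_mul]
    refine Finset.sum_congr rfl fun p _ => Finset.sum_congr rfl fun q _ =>
      Finset.sum_congr rfl fun s _ => by ring
  unfold gT
  rw [h1, h2]
  simp only [mul_sub, Finset.sum_sub_distrib]
  congr 1
  · simp
  · refine Finset.sum_congr rfl fun p _ => Finset.sum_congr rfl fun q _ => ?_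
    rw [Finset.sum_comm]
    simp

/-- Involutivity of the Gaudin Hamiltonians: the Poisson bracket `{H_i, H_j}`, computed
via the direct-sum Poisson–Lie structure
`{S^a_{pq}, S^b_{rs}} = δ^{ab}(S^a_{rq} δ_{ps} − S^a_{ps} δ_{rq})` and the chain rule,
vanishes. -/
theorem stmt14 (M N : ℕ) (hM : 1 ≤ M) (hN : 1 ≤ N)
    (zs : Fin M → ℂ) (hzs : Function.Injective zs)
    (S : Fin M → Matrix (Fin N) (Fin N) ℂ) (i j : Fin M) :
    ∑ a : Fin M, ∑ p : Fin N, ∑ q : Fin N, ∑ r : Fin N, ∑ s : Fin N,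
        gaudinGrad zs S i a p q * gaudinGrad zs S j a r s *
          (S a r q * (if p = s then (1 : ℂ) else 0) -
            S a p s * (if r = q then (1 : ℂ) else 0)) = 0 := by
  simp only [grad_eq, contract]
  by_cases hij : i = j
  · subst hij
    simp [gT_self]
  have hz : zs i - zs j ≠ 0 := sub_ne_zero.2 fun h => hij (hzs h)
  have hz' : zs j - zs i ≠ 0 := sub_ne_zero.2 fun h => hij (hzs h).symm
  have hji : ¬ j = i := fun h => hij h.symm
  have key : ∀ a, gT (S a) (gA zs S i a) (gA zs S j a) =
      (if a = i then gT (S i) (gA zs S i i) (gA zs S j i) else 0) +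
      (if a = j then gT (S j) (gA zs S i j) (gA zs S j j) else 0) +
      (zs i - zs a)⁻¹ * (zs j - zs a)⁻¹ * gT (S a) (S i) (S j) := by
    intro a
    by_cases h1 : a = i
    · subst h1
      simp [hij]
    by_cases h2 : a = j
    · subst h2
      simp [h1]
    simp only [h1, h2, if_false, gA]
    rw [gT_smul, gT_swap, gT_smul, gT_swap]
    ring
  have hi : gT (S i) (gA zs S i i) (gA zs S j i) =
      ∑ k, -((zs j - zs i)⁻¹ * (zs i - zs k)⁻¹ * gT (S k) (S i) (S j)) := by
    simp only [gA, hij, if_true, if_false]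
    rw [gT_sum]
    refine Finset.sum_congr rfl fun k _ => ?_
    rw [gT_smul, gT_swap, gT_smul, gT_swap, ← gT_cyc (S k) (S i) (S j), gT_swap (S i) (S j) (S k)]
    ring
  have hj : gT (S j) (gA zs S i j) (gA zs S j j) =
      ∑ k, -((zs i - zs j)⁻¹ * (zs j - zs k)⁻¹ * gT (S k) (S i) (S j)) := by
    simp only [gA, hji, if_true, if_false]
    rw [gT_smul, gT_swap, gT_sum, ← Finset.sum_neg_distrib, Finset.mul_sum]
    refine Finset.sum_congr rfl fun k _ => ?_
    rw [gT_smul, gT_cyc (S j) (S k) (S i)]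
    ring
  rw [Finset.sum_congr rfl fun a _ => key a]
  simp only [Finset.sum_add_distrib, Finset.sum_ite_eq', Finset.mem_univ, if_true]
  rw [hi, hj, ← Finset.sum_add_distrib, ← Finset.sum_add_distrib]
  refine Finset.sum_eq_zero fun k _ => ?_
  by_cases h1 : k = i
  · subst h1
    have : gT (S k) (S k) (S j) = 0 := by rw [← gT_cyc, ← gT_cyc, gT_self]
    simp [this]
  by_cases h2 : k = j
  · subst h2
    have : gT (S k) (S i) (S k) = 0 := by rw [← gT_cyc, gT_self]
    simp [this]
  have e1 : zs i - zs k ≠ 0 := sub_ne_zero.2 fun h => h1 (hzs h).symm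
  have e2 : zs j - zs k ≠ 0 := sub_ne_zero.2 fun h => h2 (hzs h).symm
  have e : -((zs j - zs i)⁻¹ * (zs i - zs k)⁻¹) - ((zs i - zs j)⁻¹ * (zs j - zs k)⁻¹) +
      (zs i - zs k)⁻¹ * (zs j - zs k)⁻¹ = 0 := by
    rw [← neg_sub (zs i) (zs j), inv_neg]
    field_simp
    ring
  linear_combination gT (S k) (S i) (S j) * e
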